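/- Let m = (π), p = (P) be coprime ideals of A = F_q[t], P prime. Suppose f ∈ S_{k,m}(Γ0(p)) is a p-newform of level p, i.e. Tr_1^p(f) = 0 and Tr_1^p(f|W_p^p) = 0, where W_p^p = [[0,−1],[P,0]]. Then both D₁(f) = f and D_m(f) = f|_{k,m}[[π,0],[0,1]], viewed in S_{k,m}(Γ0(mp)), are p-newforms of level mp, i.e. they lie in Ker(Tr_m^{mp}) ∩ Ker(Tr_m^{mp} ∘ W_p^{mp}). -/

import Mathlib

open Matrix

noncomputable section

/-- `Γ₀(ν)`: matrices over `F_q[t]` with unit determinant whose lower-left entry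
is divisible by `ν`. -/
def Gamma0 {Fq : Type} [Field Fq] (ν : Polynomial Fq) :
    Set (Matrix (Fin 2) (Fin 2) (Polynomial Fq)) :=
  {γ | IsUnit γ.det ∧ ν ∣ γ 1 0}

/-- Möbius (fractional linear) action of a matrix over `F_q[t]` on `C_∞`. -/
def moeb {Fq Coo : Type} [Field Fq] [Field Coo] (ι : Polynomial Fq →+* Coo)
    (M : Matrix (Fin 2) (Fin 2) (Polynomial Fq)) (z : Coo) : Coo :=
  (ι (M 0 0) * z + ι (M 0 1)) / (ι (M 1 0) * z + ι (M 1 1))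

/-- Weight-`k`, type-`m` slash operator. -/
def slash {Fq Coo : Type} [Field Fq] [Field Coo] (ι : Polynomial Fq →+* Coo)
    (k m : ℤ) (M : Matrix (Fin 2) (Fin 2) (Polynomial Fq)) (f : Coo → Coo) : Coo → Coo :=
  fun z => f (moeb ι M z) * ι M.det ^ m * (ι (M 1 0) * z + ι (M 1 1)) ^ (-k)

/-- Weak modularity: invariance of `f` under the slash action of `Γ₀(ν)`. -/
def IsWeakModular {Fq Coo : Type} [Field Fq] [Field Coo] (ι : Polynomial Fq →+* Coo)
    (k m : ℤ) (ν : Polynomial Fq) (f : Coo → Coo) : Prop :=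
  ∀ γ ∈ Gamma0 ν, slash ι k m γ f = f

/-- The operator `U_p`: `U_P(f) = P^{k-m} Σ_{deg Q < deg P} f|_{k,m}[[1,Q],[0,P]]`,
where the sum over polynomials `Q` of degree `< d = deg P` is indexed by their
coefficient tuples. -/
def heckeU {Fq Coo : Type} [Field Fq] [Fintype Fq] [Field Coo] (ι : Polynomial Fq →+* Coo)
    (k m : ℤ) (P : Polynomial Fq) (f : Coo → Coo) : Coo → Coo :=
  fun z => ι P ^ (k - m) *
    ∑ c : Fin P.natDegree → Fq,
      slash ι k m
        !![1, ∑ i : Fin P.natDegree, Polynomial.C (c i) * Polynomial.X ^ (i : ℕ); 0, P] f z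

/-- The Hecke operator `T_p` for `p = (P)` prime to the level. -/
def heckeT {Fq Coo : Type} [Field Fq] [Fintype Fq] [Field Coo] (ι : Polynomial Fq →+* Coo)
    (k m : ℤ) (P : Polynomial Fq) (f : Coo → Coo) : Coo → Coo :=
  fun z => ι P ^ (k - m) * slash ι k m !![P, 0; 0, 1] f z + heckeU ι k m P f z

/-- `W` is an Atkin–Lehner matrix for `d = (δ)` at level `n = (ν)`:
`W = [[δa, b],[νc, δd]]` with determinant `ζδ`, `ζ ∈ F_q^×`. -/
def IsAL {Fq : Type} [Field Fq] (ν δ : Polynomial Fq)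
    (W : Matrix (Fin 2) (Fin 2) (Polynomial Fq)) : Prop :=
  δ ∣ W 0 0 ∧ ν ∣ W 1 0 ∧ δ ∣ W 1 1 ∧ ∃ ζ : Fq, ζ ≠ 0 ∧ W.det = Polynomial.C ζ * δ

/-- The trace map from level `mp` down to level `m`, defined via the formula
`Tr(f) = f + P^{-m} U_p(f |_{k,m} W_p^{mp})` (Lemma `LemTr` of the paper). -/
def trMap {Fq Coo : Type} [Field Fq] [Fintype Fq] [Field Coo] (ι : Polynomial Fq →+* Coo)
    (k m : ℤ) (P : Polynomial Fq) (Wp : Matrix (Fin 2) (Fin 2) (Polynomial Fq))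
    (f : Coo → Coo) : Coo → Coo :=
  fun z => f z + ι P ^ (-m) * heckeU ι k m P (slash ι k m Wp f) z

/-- The `p`-twisted trace `Tr^{(p)}(f) = f |_{k,m} W_p^{mp} + P^{m-k} U_p(f)`. -/
def trTwP {Fq Coo : Type} [Field Fq] [Fintype Fq] [Field Coo] (ι : Polynomial Fq →+* Coo)
    (k m : ℤ) (P : Polynomial Fq) (Wp : Matrix (Fin 2) (Fin 2) (Polynomial Fq))
    (f : Coo → Coo) : Coo → Coo :=
  fun z => slash ι k m Wp f z + ι P ^ (m - k) * heckeU ι k m P f z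

section Helpers
variable {Fq Coo : Type} [Field Fq] [Field Coo]

/-- points of the form `ι a / ι b` -/
def RatPt (ι : Polynomial Fq →+* Coo) (z : Coo) : Prop := ∃ a b, z = ι a / ι b

/-- vanishing at all rational points -/
def VR (ι : Polynomial Fq →+* Coo) (f : Coo → Coo) : Prop := ∀ z, RatPt ι z → f z = 0

lemma ratPt_moeb (ι : Polynomial Fq →+* Coo) (M : Matrix (Fin 2) (Fin 2) (Polynomial Fq))
    {z : Coo} (hz : RatPt ι z) : RatPt ι (moeb ι M z) := by
  obtain ⟨a, b, rfl⟩ := hz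
  by_cases hb : ι b = 0
  · refine ⟨M 0 1, M 1 1, ?_⟩
    simp [moeb, hb]
  · refine ⟨M 0 0 * a + M 0 1 * b, M 1 0 * a + M 1 1 * b, ?_⟩
    have e1 : ι (M 0 0) * (ι a / ι b) + ι (M 0 1) = (ι (M 0 0 * a + M 0 1 * b)) / ι b := by
      simp only [map_add, map_mul]; field_simp
    have e2 : ι (M 1 0) * (ι a / ι b) + ι (M 1 1) = (ι (M 1 0 * a + M 1 1 * b)) / ι b := by
      simp only [map_add, map_mul]; field_simp
    rw [moeb, e1, e2, div_div_div_cancel_right₀ hb]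

lemma VR_slash {ι : Polynomial Fq →+* Coo} (k m : ℤ)
    (M : Matrix (Fin 2) (Fin 2) (Polynomial Fq)) {f : Coo → Coo} (hf : VR ι f) :
    VR ι (slash ι k m M f) := by
  intro z hz
  simp [slash, hf _ (ratPt_moeb ι M hz)]

lemma den_ne {ι : Polynomial Fq →+* Coo} {c d : Polynomial Fq} {z : Coo} (hz : ¬ RatPt ι z)
    (h : ι c ≠ 0 ∨ ι d ≠ 0) : ι c * z + ι d ≠ 0 := by
  intro h0
  by_cases hc : ι c = 0
  · simp [hc] at h0 h; exact h h0
  · apply hz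
    refine ⟨-d, c, ?_⟩
    rw [eq_div_iff hc, map_neg]
    linear_combination h0

lemma slash_slash {ι : Polynomial Fq →+* Coo} (k m : ℤ)
    (M N : Matrix (Fin 2) (Fin 2) (Polynomial Fq)) (hM : ι M.det ≠ 0) (hN : ι N.det ≠ 0)
    {f : Coo → Coo} (hf : VR ι f) :
    slash ι k m M (slash ι k m N f) = slash ι k m (N * M) f := by
  funext z
  by_cases hz : RatPt ι z
  · rw [VR_slash k m M (VR_slash k m N hf) z hz, VR_slash k m _ hf z hz]
  have key : ∀ (M : Matrix (Fin 2) (Fin 2) (Polynomial Fq)), ι M.det ≠ 0 →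
      ι (M 1 0) * z + ι (M 1 1) ≠ 0 := by
    intro M hM
    apply den_ne hz
    by_contra h
    push Not at h
    apply hM
    simp [Matrix.det_fin_two, h.1, h.2]
  have hNM : ι (N * M).det ≠ 0 := by
    rw [Matrix.det_mul, map_mul]; exact mul_ne_zero hN hM
  have d1 := key M hM
  have d2 := key _ hNM
  have e1 : ι (N 1 0) * moeb ι M z + ι (N 1 1) =
      (ι ((N * M) 1 0) * z + ι ((N * M) 1 1)) / (ι (M 1 0) * z + ι (M 1 1)) := by
    simp only [moeb, Matrix.mul_apply, Fin.sum_univ_two, map_add, map_mul]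
    rw [eq_div_iff d1, add_mul, mul_assoc, div_mul_cancel₀ _ d1]; ring
  have e0 : ι (N 0 0) * moeb ι M z + ι (N 0 1) =
      (ι ((N * M) 0 0) * z + ι ((N * M) 0 1)) / (ι (M 1 0) * z + ι (M 1 1)) := by
    simp only [moeb, Matrix.mul_apply, Fin.sum_univ_two, map_add, map_mul]
    rw [eq_div_iff d1, add_mul, mul_assoc, div_mul_cancel₀ _ d1]; ring
  have e2 : moeb ι N (moeb ι M z) = moeb ι (N * M) z := by
    rw [moeb, e0, e1, div_div_div_cancel_right₀ d1, ← moeb]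
  simp only [slash]
  rw [e2, e1, Matrix.det_mul, map_mul, mul_zpow, div_zpow]
  have h3 := zpow_ne_zero (-k) d1
  generalize (ι (M 1 0) * z + ι (M 1 1)) ^ (-k) = w at h3 ⊢
  field_simp

lemma slash_gamma {ι : Polynomial Fq →+* Coo} {k m : ℤ} {P : Polynomial Fq} {h : Coo → Coo}
    (hV : VR ι h) (hh : IsWeakModular ι k m P h) {γ : Matrix (Fin 2) (Fin 2) (Polynomial Fq)}
    (hγ : γ ∈ Gamma0 P) (M : Matrix (Fin 2) (Fin 2) (Polynomial Fq)) (hM : ι M.det ≠ 0) :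
    slash ι k m (γ * M) h = slash ι k m M h := by
  rw [← slash_slash k m M γ hM (hγ.1.map ι).ne_zero hV, hh γ hγ]

lemma weak_W {ι : Polynomial Fq →+* Coo} {k m : ℤ} {P : Polynomial Fq} {h : Coo → Coo}
    (hP : ι P ≠ 0) (hV : VR ι h) (hh : IsWeakModular ι k m P h) :
    IsWeakModular ι k m P (slash ι k m !![0, -1; P, 0] h) := by
  intro γ hγ
  have hW : ι (!![0, -1; P, 0] : Matrix (Fin 2) (Fin 2) (Polynomial Fq)).det ≠ 0 := by
    simpa [Matrix.det_fin_two] using hP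
  obtain ⟨h1, c, hc⟩ := hγ
  rw [slash_slash k m _ _ (h1.map ι).ne_zero hW hV]
  have : (!![0, -1; P, 0] : Matrix (Fin 2) (Fin 2) (Polynomial Fq)) * γ =
      !![γ 1 1, -c; -(P * γ 0 1), γ 0 0] * !![0, -1; P, 0] := by
    ext i j
    fin_cases i <;> fin_cases j <;> simp [Matrix.mul_apply, Fin.sum_univ_two, hc] <;> ring
  rw [this]
  apply slash_gamma hV hh _ _ hW
  refine ⟨?_, by simp⟩
  rw [Matrix.det_fin_two, hc] at h1
  convert h1 using 1
  simp [Matrix.det_fin_two]; ring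

lemma slash_W' {ι : Polynomial Fq →+* Coo} {k m : ℤ} {π P α β : Polynomial Fq} {h : Coo → Coo}
    (hP : ι P ≠ 0) (hαβ : α * P + β * π = 1) (hV : VR ι h) (hh : IsWeakModular ι k m P h) :
    slash ι k m !![P, -β; π * P, α * P] h = slash ι k m !![0, -1; P, 0] h := by
  have hW : ι (!![0, -1; P, 0] : Matrix (Fin 2) (Fin 2) (Polynomial Fq)).det ≠ 0 := by
    simpa [Matrix.det_fin_two] using hP
  have : (!![P, -β; π * P, α * P] : Matrix (Fin 2) (Fin 2) (Polynomial Fq)) =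
      !![β, 1; -(P * α), π] * !![0, -1; P, 0] := by
    ext i j
    fin_cases i <;> fin_cases j <;> simp [Matrix.mul_apply, Fin.sum_univ_two] <;> ring
  rw [this]
  apply slash_gamma hV hh _ _ hW
  refine ⟨?_, by simp⟩
  have e : (!![β, 1; -(P * α), π] : Matrix (Fin 2) (Fin 2) (Polynomial Fq)).det = 1 := by
    simp [Matrix.det_fin_two]; linear_combination hαβ
  rw [e]; exact isUnit_one

lemma slash_W'_D {ι : Polynomial Fq →+* Coo} {k m : ℤ} {π P α β : Polynomial Fq} {h : Coo → Coo}
    (hP : ι P ≠ 0) (hπ : ι π ≠ 0) (hαβ : α * P + β * π = 1) (hV : VR ι h)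
    (hh : IsWeakModular ι k m P h) :
    slash ι k m !![P, -β; π * P, α * P] (slash ι k m !![π, 0; 0, 1] h) =
      slash ι k m !![π, 0; 0, 1] (slash ι k m !![0, -1; P, 0] h) := by
  have hW : ι (!![0, -1; P, 0] : Matrix (Fin 2) (Fin 2) (Polynomial Fq)).det ≠ 0 := by
    simpa [Matrix.det_fin_two] using hP
  have hD : ι (!![π, 0; 0, 1] : Matrix (Fin 2) (Fin 2) (Polynomial Fq)).det ≠ 0 := by
    simpa [Matrix.det_fin_two] using hπ
  have hW' : ι (!![P, -β; π * P, α * P] : Matrix (Fin 2) (Fin 2) (Polynomial Fq)).det ≠ 0 := by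
    have : (!![P, -β; π * P, α * P] : Matrix (Fin 2) (Fin 2) (Polynomial Fq)).det = P := by
      simp [Matrix.det_fin_two]; linear_combination P * hαβ
    rwa [this]
  rw [slash_slash k m _ _ hW' hD hV, slash_slash k m _ _ hD hW hV]
  have : (!![π, 0; 0, 1] : Matrix (Fin 2) (Fin 2) (Polynomial Fq)) * !![P, -β; π * P, α * P] =
      !![β * π, 1; -(P * α), 1] * (!![0, -1; P, 0] * !![π, 0; 0, 1]) := by
    ext i j
    fin_cases i <;> fin_cases j <;> simp [Matrix.mul_apply, Fin.sum_univ_two] <;> ring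
  rw [this]
  apply slash_gamma hV hh
  · refine ⟨?_, by simp⟩
    have e : (!![β * π, 1; -(P * α), 1] : Matrix (Fin 2) (Fin 2) (Polynomial Fq)).det = 1 := by
      simp [Matrix.det_fin_two]; linear_combination hαβ
    rw [e]; exact isUnit_one
  · rw [Matrix.det_mul, map_mul]; exact mul_ne_zero hW hD

/-- polynomial with given coefficient tuple -/
def tupPoly {n : ℕ} (c : Fin n → Fq) : Polynomial Fq :=
  ∑ i : Fin n, Polynomial.C (c i) * Polynomial.X ^ (i : ℕ)

lemma tupPoly_deg {n : ℕ} (c : Fin n → Fq) : (tupPoly c).degree < n := by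
  refine (Polynomial.degree_sum_le _ _).trans_lt ?_
  refine (Finset.sup_lt_iff (WithBot.bot_lt_coe n)).mpr ?_
  intro i _
  refine (Polynomial.degree_C_mul_X_pow_le _ _).trans_lt ?_
  exact WithBot.coe_lt_coe.mpr i.2

lemma tupPoly_coeff {n : ℕ} (c : Fin n → Fq) (j : Fin n) : (tupPoly c).coeff j = c j := by
  simp only [tupPoly, Polynomial.finsetSum_coeff, Polynomial.coeff_C_mul, Polynomial.coeff_X_pow]
  rw [Finset.sum_eq_single j] <;> simp
  intro b hb h
  exact absurd (Fin.ext h.symm) hb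

lemma tupPoly_of_deg {n : ℕ} {r : Polynomial Fq} (h : r.degree < n) :
    tupPoly (fun i : Fin n => r.coeff i) = r := by
  ext j
  by_cases hj : j < n
  · exact tupPoly_coeff (fun i : Fin n => r.coeff i) ⟨j, hj⟩
  · have hj' : (n : WithBot ℕ) ≤ j := by exact_mod_cast not_lt.mp hj
    rw [Polynomial.coeff_eq_zero_of_degree_lt ((tupPoly_deg _).trans_le hj'),
      Polynomial.coeff_eq_zero_of_degree_lt (h.trans_le hj')]

lemma deg_lt_not_dvd {P Q : Polynomial Fq} (hQ : Q.degree < P.natDegree) (h : P ∣ Q) : Q = 0 := by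
  by_contra h0
  have := Polynomial.degree_le_of_dvd h h0
  rw [Polynomial.degree_eq_natDegree (fun hp => h0 (by simpa [hp] using h))] at this
  exact absurd hQ (not_lt.mpr this)

lemma heckeU_D [Fintype Fq] {ι : Polynomial Fq →+* Coo} {k m : ℤ} {π P : Polynomial Fq}
    {h : Coo → Coo} (hPm : P.Monic) (hirr : Irreducible P) (hcop : IsCoprime π P)
    (hP : ι P ≠ 0) (hπ : ι π ≠ 0) (hV : VR ι h) (hh : IsWeakModular ι k m P h) :
    heckeU ι k m P (slash ι k m !![π, 0; 0, 1] h) =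
      slash ι k m !![π, 0; 0, 1] (heckeU ι k m P h) := by
  have hD : ι (!![π, 0; 0, 1] : Matrix (Fin 2) (Fin 2) (Polynomial Fq)).det ≠ 0 := by
    simpa [Matrix.det_fin_two] using hπ
  have hQ : ∀ Q : Polynomial Fq,
      ι (!![1, Q; 0, P] : Matrix (Fin 2) (Fin 2) (Polynomial Fq)).det ≠ 0 := by
    intro Q; simpa [Matrix.det_fin_two] using hP
  let φ : (Fin P.natDegree → Fq) → (Fin P.natDegree → Fq) :=
    fun c i => ((π * tupPoly c) %ₘ P).coeff i
  have hdeg : ∀ R : Polynomial Fq, (R %ₘ P).degree < P.natDegree := by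
    intro R
    rw [← Polynomial.degree_eq_natDegree hPm.ne_zero]
    exact Polynomial.degree_modByMonic_lt _ hPm
  have hφ : ∀ c, tupPoly (φ c) = (π * tupPoly c) %ₘ P := fun c => tupPoly_of_deg (hdeg _)
  have hinj : Function.Injective φ := by
    intro c c' e
    have e1 : (π * tupPoly c) %ₘ P = (π * tupPoly c') %ₘ P := by rw [← hφ, ← hφ, e]
    have e2 : P ∣ π * (tupPoly c - tupPoly c') := by
      refine ⟨(π * tupPoly c) /ₘ P - (π * tupPoly c') /ₘ P, ?_⟩
      have a1 := Polynomial.modByMonic_add_div (π * tupPoly c) P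
      have a2 := Polynomial.modByMonic_add_div (π * tupPoly c') P
      linear_combination a2 - a1 + e1
    have e3 := hcop.symm.dvd_of_dvd_mul_left e2
    have e4 := deg_lt_not_dvd ((Polynomial.degree_sub_le _ _).trans_lt
      (max_lt (tupPoly_deg c) (tupPoly_deg c'))) e3
    funext j
    rw [← tupPoly_coeff c, ← tupPoly_coeff c', sub_eq_zero.mp e4]
  have hbij : Function.Bijective φ := Finite.injective_iff_bijective.mp hinj
  have hterm : ∀ c, slash ι k m !![1, tupPoly c; 0, P] (slash ι k m !![π, 0; 0, 1] h) =
      slash ι k m !![π, 0; 0, 1] (slash ι k m !![1, tupPoly (φ c); 0, P] h) := by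
    intro c
    rw [slash_slash k m _ _ (hQ _) hD hV, slash_slash k m _ _ hD (hQ _) hV]
    have : (!![π, 0; 0, 1] : Matrix (Fin 2) (Fin 2) (Polynomial Fq)) * !![1, tupPoly c; 0, P] =
        !![1, (π * tupPoly c) /ₘ P; 0, 1] * (!![1, tupPoly (φ c); 0, P] * !![π, 0; 0, 1]) := by
      have a1 := Polynomial.modByMonic_add_div (π * tupPoly c) P
      rw [hφ]
      generalize (π * tupPoly c) %ₘ P = r at a1 ⊢
      generalize (π * tupPoly c) /ₘ P = s at a1 ⊢
      rw [Matrix.mul_fin_two, Matrix.mul_fin_two, Matrix.mul_fin_two]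
      simp [← a1, mul_comm]
    rw [this]
    apply slash_gamma hV hh
    · exact ⟨by simp [Matrix.det_fin_two], by simp⟩
    · rw [Matrix.det_mul, map_mul]; exact mul_ne_zero (hQ _) hD
  funext z
  have : heckeU ι k m P (slash ι k m !![π, 0; 0, 1] h) z = ι P ^ (k - m) *
      ∑ c : Fin P.natDegree → Fq, slash ι k m !![1, tupPoly c; 0, P]
        (slash ι k m !![π, 0; 0, 1] h) z := rfl
  rw [this]
  simp_rw [hterm]
  rw [Fintype.sum_bijective φ hbij _
    (fun c => slash ι k m !![π, 0; 0, 1] (slash ι k m !![1, tupPoly c; 0, P] h) z)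
    (fun c => rfl)]
  simp only [slash, heckeU, tupPoly]
  rw [Finset.mul_sum, Finset.mul_sum, Finset.sum_mul, Finset.sum_mul]
  refine Finset.sum_congr rfl fun c _ => ?_
  ring

lemma sum_const_zero [Fintype Fq] (ι : Polynomial Fq →+* Coo) {n : ℕ} (hn : 0 < n) (x : Coo) :
    ∑ _c : Fin n → Fq, x = 0 := by
  have h0 : ((Fintype.card Fq : ℕ) : Coo) = 0 := by
    have h1 : ((Fintype.card Fq : ℕ) : Fq) = 0 := FiniteField.cast_card_eq_zero Fq
    have h2 := congrArg (ι.comp Polynomial.C) h1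
    simpa only [map_natCast, map_zero] using h2
  rw [Finset.sum_const, Finset.card_univ, Fintype.card_fun, Fintype.card_fin, nsmul_eq_mul,
    Nat.cast_pow, h0, zero_pow hn.ne', zero_mul]

lemma vanish_inf {ι : Polynomial Fq →+* Coo} {k m : ℤ} {P : Polynomial Fq} {f : Coo → Coo}
    (hf : IsWeakModular ι k m P f) {a b : Polynomial Fq} (hab : IsCoprime a b) (hPb : P ∣ b)
    (hb : ι b ≠ 0) : f (ι a / ι b) = f 0 * 0 ^ (-k) := by
  obtain ⟨x, y, hxy⟩ := hab
  have hdet : (!![-x, -y; b, -a] : Matrix (Fin 2) (Fin 2) (Polynomial Fq)).det = 1 := by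
    rw [← hxy]; simp [Matrix.det_fin_two]
  have h := hf !![-x, -y; b, -a] ⟨by rw [hdet]; exact isUnit_one, by simpa using hPb⟩
  have h' := congrFun h (ι a / ι b)
  have hd : ι b * (ι a / ι b) + -ι a = 0 := by rw [mul_div_cancel₀ _ hb, add_neg_cancel]
  rw [← h']
  simp only [slash, hdet, moeb]
  simp [hd]

lemma rat_zero {ι : Polynomial Fq →+* Coo} {k m : ℤ} {P : Polynomial Fq} {f : Coo → Coo}
    (hirr : Irreducible P) (hf : IsWeakModular ι k m P f) {z : Coo} (hz : RatPt ι z) :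
    ∃ y, f z = f 0 * y ^ (-k) := by
  obtain ⟨a, b, rfl⟩ := hz
  by_cases hb : ι b = 0
  · exact ⟨1, by simp [hb]⟩
  have hb0 : b ≠ 0 := by rintro rfl; simp at hb
  obtain ⟨g, a', b', hg, hco, ha', hb'⟩ : ∃ g a' b' : Polynomial Fq, g ≠ 0 ∧ IsCoprime a' b' ∧
      a = g * a' ∧ b = g * b' := by
    classical
    have hg : EuclideanDomain.gcd a b ≠ 0 :=
      fun h => hb0 (EuclideanDomain.gcd_eq_zero_iff.mp h).2
    obtain ⟨a', ha'⟩ := EuclideanDomain.gcd_dvd_left a b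
    obtain ⟨b', hb'⟩ := EuclideanDomain.gcd_dvd_right a b
    have hbez := EuclideanDomain.gcd_eq_gcd_ab a b
    generalize EuclideanDomain.gcdA a b = x at hbez
    generalize EuclideanDomain.gcdB a b = y at hbez
    generalize EuclideanDomain.gcd a b = g at hg ha' hb' hbez
    refine ⟨g, a', b', hg, ⟨x, y, mul_left_cancel₀ hg ?_⟩, ha', hb'⟩
    linear_combination -hbez - x * ha' - y * hb'
  rw [hb', map_mul] at hb
  have hgι := left_ne_zero_of_mul hb
  have hbι := right_ne_zero_of_mul hb
  have e : ι a / ι b = ι a' / ι b' := by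
    rw [ha', hb', map_mul, map_mul, mul_div_mul_left _ _ hgι]
  rw [e]
  by_cases hPb : P ∣ b'
  · exact ⟨0, vanish_inf hf hco hPb hbι⟩
  · have hc2 : IsCoprime b' (a' * P) :=
      hco.symm.mul_right ((hirr.coprime_iff_not_dvd.mpr hPb).symm)
    obtain ⟨x, y, hxy⟩ := hc2
    have hdet : (!![b', -a'; P * y, x] : Matrix (Fin 2) (Fin 2) (Polynomial Fq)).det = 1 := by
      rw [← hxy]; simp [Matrix.det_fin_two]; ring
    have h := hf !![b', -a'; P * y, x] ⟨by rw [hdet]; exact isUnit_one, by simp⟩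
    have h' := congrFun h (ι a' / ι b')
    have hd : ι b' * (ι a' / ι b') + -ι a' = 0 := by rw [mul_div_cancel₀ _ hbι, add_neg_cancel]
    refine ⟨ι (P * y) * (ι a' / ι b') + ι x, ?_⟩
    rw [← h']
    simp only [slash, hdet, moeb]
    simp [hd]

lemma VR_of_newform [Fintype Fq] {ι : Polynomial Fq →+* Coo} {k m : ℤ} {P : Polynomial Fq}
    {f : Coo → Coo} (hPm : P.Monic) (hirr : Irreducible P) (hP : ι P ≠ 0)
    (hf : IsWeakModular ι k m P f)
    (hTr1 : trMap ι k m P !![0, -1; P, 0] f = 0)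
    (hTr1p : trMap ι k m P !![0, -1; P, 0] (slash ι k m !![0, -1; P, 0] f) = 0) : VR ι f := by
  have hdegpos : 0 < P.natDegree := hirr.natDegree_pos
  suffices hf0 : f 0 = 0 by
    intro z hz
    obtain ⟨y, hy⟩ := rat_zero hirr hf hz
    rw [hy, hf0, zero_mul]
  by_cases hk : k = 0
  · subst hk
    have hc : ∀ z, RatPt ι z → f z = f 0 := by
      intro z hz
      obtain ⟨y, hy⟩ := rat_zero hirr hf hz
      simpa using hy
    have h0 : RatPt ι (0 : Coo) := ⟨0, 0, by simp⟩
    have h := congrFun hTr1 0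
    simp only [trMap, heckeU, Pi.zero_apply] at h
    have hs : ∀ c : Fin P.natDegree → Fq, slash ι 0 m
        !![1, ∑ i : Fin P.natDegree, Polynomial.C (c i) * Polynomial.X ^ (i : ℕ); 0, P]
          (slash ι 0 m !![0, -1; P, 0] f) 0 = f 0 * ι P ^ m * ι P ^ m := by
      intro c
      simp only [slash]
      rw [hc _ (ratPt_moeb ι _ (ratPt_moeb ι _ h0))]
      simp [Matrix.det_fin_two]
    simp_rw [hs] at h
    rw [sum_const_zero ι hdegpos] at h
    simpa using h
  · have hk' : -k ≠ 0 := neg_ne_zero.mpr hk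
    have hinf : ∀ {a b : Polynomial Fq}, IsCoprime a b → P ∣ b → ι b ≠ 0 →
        f (ι a / ι b) = 0 := by
      intro a b hab hPb hb
      rw [vanish_inf hf hab hPb hb, _root_.zero_zpow _ hk', mul_zero]
    have hWW : ∀ z : Coo, ∃ y, slash ι k m !![0, -1; P, 0]
        (slash ι k m !![0, -1; P, 0] f) z = f z * y ∧ (z ≠ 0 → y ≠ 0) := by
      intro z
      by_cases hz : z = 0
      · subst hz
        refine ⟨0, ?_, by simp⟩
        have e : (ι P * 0 + ι 0) ^ (-k) = 0 := by
          rw [mul_zero, map_zero, add_zero, _root_.zero_zpow _ hk']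
        rw [slash]
        simp only [Matrix.of_apply, Matrix.cons_val', Matrix.cons_val_zero,
          Matrix.cons_val_one, Matrix.cons_val_fin_one, e]
        rw [mul_zero, mul_zero]
      have e1 : ι P * (-1 / (ι P * z)) = -(1 / z) := by field_simp
      have e2 : -1 / (-(1 / z)) = z := by field_simp
      refine ⟨ι P ^ m * (-(1 / z)) ^ (-k) * ι P ^ m * (ι P * z) ^ (-k), ?_, fun _ => ?_⟩
      · simp only [slash, moeb]
        simp only [Matrix.det_fin_two, Matrix.of_apply, Matrix.cons_val', Matrix.cons_val_zero,
          Matrix.cons_val_one, Matrix.cons_val_fin_one, map_zero, zero_mul, zero_add, map_neg,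
          map_one, add_zero, neg_mul, one_mul, sub_neg_eq_add, mul_zero, e1, e2]
        ring
      · have hz' : -(1 / z) ≠ 0 := by simpa using hz
        have h1 := zpow_ne_zero m hP
        exact mul_ne_zero (mul_ne_zero (mul_ne_zero h1 (zpow_ne_zero _ hz')) h1)
          (zpow_ne_zero _ (mul_ne_zero hP hz))
    have h := congrFun hTr1p (ι P)
    simp only [trMap, heckeU, Pi.zero_apply] at h
    have hg : slash ι k m !![0, -1; P, 0] f (ι P) = 0 := by
      have h1 : f (ι (-1) / ι (P * P)) = 0 :=
        hinf isCoprime_one_left.neg_left (dvd_mul_right P P)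
          (by rw [map_mul]; exact mul_ne_zero hP hP)
      have h2 : moeb ι !![0, -1; P, 0] (ι P) = ι (-1) / ι (P * P) := by
        simp [moeb]
      simp only [slash, h2, h1, zero_mul]
    rw [hg, zero_add, Finset.sum_eq_single 0] at h
    · obtain ⟨y, hy, hy0⟩ := hWW 1
      have h2 : moeb ι !![1, 0; 0, P] (ι P) = 1 := by
        simp [moeb, hP]
      have h3 : slash ι k m !![1, 0; 0, P]
          (slash ι k m !![0, -1; P, 0] (slash ι k m !![0, -1; P, 0] f)) (ι P) =
          f 1 * y * ι P ^ m * ι P ^ (-k) := by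
        rw [slash, h2, hy]
        simp [Matrix.det_fin_two]
      simp only [Pi.zero_apply, map_zero, zero_mul, Finset.sum_const_zero] at h
      rw [h3] at h
      have hf1 : f 1 = 0 := by
        have := hy0 one_ne_zero
        simpa [zpow_ne_zero, hP, this] using h
      have h4 := congrFun (hf !![1, 1; 0, 1] ⟨by simp [Matrix.det_fin_two], by simp⟩) 0
      rw [← h4]
      simp [slash, moeb, hf1]
    · intro c _ hc
      change slash ι k m !![1, tupPoly c; 0, P] _ _ = 0
      have hne : tupPoly c ≠ 0 := by
        intro h0
        apply hc
        funext j
        rw [← tupPoly_coeff c, h0]; simp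
      have hcop : IsCoprime (P + tupPoly c) P := by
        have : IsCoprime P (tupPoly c) := hirr.coprime_iff_not_dvd.mpr
          (fun hd => hne (deg_lt_not_dvd (tupPoly_deg c) hd))
        simpa [add_comm] using this.symm.add_mul_left_left 1
      have h2 : moeb ι !![1, tupPoly c; 0, P] (ι P) = ι (P + tupPoly c) / ι P := by
        simp [moeb]
      obtain ⟨y, hy, -⟩ := hWW (ι (P + tupPoly c) / ι P)
      rw [slash, h2, hy, hinf hcop dvd_rfl hP]
      simp
    · simp

lemma heckeU_zero_of_P [Fintype Fq] {ι : Polynomial Fq →+* Coo} {k m : ℤ} {P : Polynomial Fq}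
    (hirr : Irreducible P) (hP : ι P = 0) (h : Coo → Coo) : heckeU ι k m P h = 0 := by
  funext z
  have : heckeU ι k m P h z = ι P ^ (k - m) * ∑ _c : Fin P.natDegree → Fq,
      (h 0 * 0 ^ m * 0 ^ (-k)) := by
    simp only [heckeU, slash, moeb]
    simp [hP, Matrix.det_fin_two]
  rw [this, sum_const_zero ι hirr.natDegree_pos, mul_zero, Pi.zero_apply]

lemma slash_zero (ι : Polynomial Fq →+* Coo) (k m : ℤ)
    (M : Matrix (Fin 2) (Fin 2) (Polynomial Fq)) : slash ι k m M 0 = 0 := by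
  funext z; simp [slash]

lemma trMap_zero [Fintype Fq] (ι : Polynomial Fq →+* Coo) (k m : ℤ) (P : Polynomial Fq)
    (M : Matrix (Fin 2) (Fin 2) (Polynomial Fq)) : trMap ι k m P M 0 = 0 := by
  funext z; simp [trMap, heckeU, slash_zero]

lemma trMap_W' [Fintype Fq] {ι : Polynomial Fq →+* Coo} {k m : ℤ} {π P α β : Polynomial Fq}
    {h : Coo → Coo}
    (hP : ι P ≠ 0) (hαβ : α * P + β * π = 1) (hV : VR ι h) (hh : IsWeakModular ι k m P h) :
    trMap ι k m P !![P, -β; π * P, α * P] h = trMap ι k m P !![0, -1; P, 0] h := by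
  unfold trMap
  rw [slash_W' hP hαβ hV hh]

lemma trMap_W'_D [Fintype Fq] {ι : Polynomial Fq →+* Coo} {k m : ℤ} {π P α β : Polynomial Fq}
    {h : Coo → Coo} (hPm : P.Monic) (hirr : Irreducible P) (hcop : IsCoprime π P)
    (hP : ι P ≠ 0) (hπ : ι π ≠ 0) (hαβ : α * P + β * π = 1) (hV : VR ι h)
    (hh : IsWeakModular ι k m P h) :
    trMap ι k m P !![P, -β; π * P, α * P] (slash ι k m !![π, 0; 0, 1] h) =
      slash ι k m !![π, 0; 0, 1] (trMap ι k m P !![0, -1; P, 0] h) := by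
  unfold trMap
  rw [slash_W'_D hP hπ hαβ hV hh,
    heckeU_D hPm hirr hcop hP hπ (VR_slash k m _ hV) (weak_W hP hV hh)]
  funext z
  simp only [slash]
  ring

end Helpers

/-- Lemma `NewDiffLev`: if `f ∈ S_{k,m}(Γ₀(P))` is a `p`-newform
of level `(P)` (i.e. `Tr_1^p(f) = 0` and `Tr_1^p(f|W_p^p) = 0`, where
`W_p^p = [[0,−1],[P,0]]`), then `D₁(f) = f` and `D_m(f) = f|[[π,0],[0,1]]` are
`p`-newforms of level `(πP)`, i.e. they are killed by `Tr_m^{mp}` and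
`Tr_m^{mp} ∘ W_p^{mp}`, where `W_p^{mp} = [[P,−β],[πP,αP]]` with `αP + βπ = 1`. -/
theorem newforms_from_lower_level {Fq Coo : Type} [Field Fq] [Fintype Fq] [Field Coo]
    (ι : Polynomial Fq →+* Coo) (k m : ℤ)
    (π P α β : Polynomial Fq)
    (hP : P.Monic) (hPirr : Irreducible P) (hcop : IsCoprime π P)
    (hαβ : α * P + β * π = 1)
    (f : Coo → Coo) (hf : IsWeakModular ι k m P f)
    (hTr1 : trMap ι k m P !![0, -1; P, 0] f = 0)
    (hTr1p : trMap ι k m P !![0, -1; P, 0] (slash ι k m !![0, -1; P, 0] f) = 0) :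
    trMap ι k m P !![P, -β; π * P, α * P] f = 0 ∧
    trMap ι k m P !![P, -β; π * P, α * P] (slash ι k m !![P, -β; π * P, α * P] f) = 0 ∧
    trMap ι k m P !![P, -β; π * P, α * P] (slash ι k m !![π, 0; 0, 1] f) = 0 ∧
    trMap ι k m P !![P, -β; π * P, α * P]
      (slash ι k m !![P, -β; π * P, α * P] (slash ι k m !![π, 0; 0, 1] f)) = 0 := by
  by_cases hP0 : ι P = 0
  · have hf0 : f = 0 := by
      rw [← hTr1]
      funext z
      simp [trMap, heckeU_zero_of_P hPirr hP0]
    subst hf0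
    simp only [slash_zero, trMap_zero, and_self]
  have hV := VR_of_newform hP hPirr hP0 hf hTr1 hTr1p
  have hVg := VR_slash k m !![0, -1; P, 0] hV
  have hg := weak_W hP0 hV hf
  refine ⟨?_, ?_, ?_⟩
  · rw [trMap_W' hP0 hαβ hV hf, hTr1]
  · rw [slash_W' hP0 hαβ hV hf, trMap_W' hP0 hαβ hVg hg, hTr1p]
  by_cases hπ : ι π = 0
  · have hD : slash ι k m !![π, 0; 0, 1] f = 0 := by
      funext z
      have : f 0 = 0 := hV 0 ⟨0, 0, by simp⟩
      simp [slash, moeb, hπ, this]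
    rw [hD]
    simp only [slash_zero, trMap_zero, and_self]
  · refine ⟨?_, ?_⟩
    · rw [trMap_W'_D hP hPirr hcop hP0 hπ hαβ hV hf, hTr1, slash_zero]
    · rw [slash_W'_D hP0 hπ hαβ hV hf, trMap_W'_D hP hPirr hcop hP0 hπ hαβ hVg hg, hTr1p,
        slash_zero]
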